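/- The squared Cramér distance between finite mixtures is bounded by the largest componentwise squared distance: let ι be a finite nonempty index set, let w : ι → ℝ satisfy w_i ≥ 0 and ∑_i w_i = 1, and let P_i, Q_i (i ∈ ι) be Borel probability measures on ℝ. Then ℓ₂²(∑_i w_i P_i, ∑_i w_i Q_i) ≤ max_{i ∈ ι} ℓ₂²(P_i, Q_i). -/

import Mathlib

open MeasureTheory

/-- Cumulative distribution function of a Borel measure on ℝ. -/
noncomputable def cdf (P : Measure ℝ) (x : ℝ) : ℝ := (P (Set.Iic x)).toReal

/-- Squared Cramér distance, valued in `[0,∞]`. -/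
noncomputable def cramerSq (P Q : Measure ℝ) : ENNReal :=
  ∫⁻ x, ENNReal.ofReal ((cdf P x - cdf Q x) ^ 2)

/-- Cramér distance, valued in `[0,∞]`. -/
noncomputable def cramer (P Q : Measure ℝ) : ENNReal :=
  cramerSq P Q ^ (1 / 2 : ℝ)

theorem cdf_sum_smul {ι : Type*} [Fintype ι] (w : ι → ℝ) (hw : ∀ i, 0 ≤ w i)
    (P : ι → Measure ℝ) [∀ i, IsFiniteMeasure (P i)] (x : ℝ) :
    cdf (∑ i, ENNReal.ofReal (w i) • P i) x = ∑ i, w i * cdf (P i) x := by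
  simp only [cdf, Measure.coe_finsetSum, Finset.sum_apply, Measure.smul_apply, smul_eq_mul]
  rw [ENNReal.toReal_sum fun i _ ↦ ENNReal.mul_ne_top ENNReal.ofReal_ne_top (measure_ne_top _ _)]
  simp only [ENNReal.toReal_mul, ENNReal.toReal_ofReal (hw _)]

theorem measurable_cdf (P : Measure ℝ) [IsFiniteMeasure P] : Measurable (cdf P) :=
  Monotone.measurable fun _ _ h ↦
    ENNReal.toReal_mono (measure_ne_top _ _) (measure_mono (Set.Iic_subset_Iic.2 h))

/-- The squared Cramér distance is jointly convex. -/
theorem cramerSq_mixture_le_sum {ι : Type*} [Fintype ι]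
    (w : ι → ℝ) (hw : ∀ i, 0 ≤ w i) (hsum : ∑ i, w i = 1)
    (P Q : ι → Measure ℝ) [∀ i, IsFiniteMeasure (P i)] [∀ i, IsFiniteMeasure (Q i)] :
    cramerSq (∑ i, ENNReal.ofReal (w i) • P i) (∑ i, ENNReal.ofReal (w i) • Q i)
      ≤ ∑ i, ENNReal.ofReal (w i) * cramerSq (P i) (Q i) := by
  have hmeas (i : ι) :
      Measurable fun x ↦ ENNReal.ofReal ((cdf (P i) x - cdf (Q i) x) ^ 2) :=
    (((measurable_cdf (P i)).sub (measurable_cdf (Q i))).pow_const 2).ennreal_ofReal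
  simp only [cramerSq]
  simp_rw [← lintegral_const_mul _ (hmeas _)]
  rw [← lintegral_finsetSum _ fun i _ ↦ (hmeas i).const_mul _]
  refine lintegral_mono fun x ↦ ?_
  simp only [cdf_sum_smul w hw, ← ENNReal.ofReal_mul (hw _)]
  rw [← ENNReal.ofReal_sum_of_nonneg fun i _ ↦ mul_nonneg (hw i) (sq_nonneg _),
    ← Finset.sum_sub_distrib]
  simp only [← mul_sub]
  exact ENNReal.ofReal_le_ofReal <| Real.pow_arith_mean_le_arith_mean_pow_of_even _ _ _
    (fun i _ ↦ hw i) hsum even_two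

/-- The squared Cramér distance between finite mixtures is bounded by the
largest componentwise squared distance. -/
theorem cramerSq_mixture_le_max {ι : Type*} [Fintype ι] [Nonempty ι]
    (w : ι → ℝ) (hw : ∀ i, 0 ≤ w i) (hsum : ∑ i, w i = 1)
    (P Q : ι → Measure ℝ)
    [∀ i, IsProbabilityMeasure (P i)] [∀ i, IsProbabilityMeasure (Q i)] :
    cramerSq (∑ i, ENNReal.ofReal (w i) • P i) (∑ i, ENNReal.ofReal (w i) • Q i)
      ≤ ⨆ i, cramerSq (P i) (Q i) := by
  calc
    _ ≤ ∑ i, ENNReal.ofReal (w i) * cramerSq (P i) (Q i) :=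
      cramerSq_mixture_le_sum w hw hsum P Q
    _ ≤ ∑ i, ENNReal.ofReal (w i) * ⨆ j, cramerSq (P j) (Q j) := by
      gcongr with i
      exact le_iSup (fun j ↦ cramerSq (P j) (Q j)) i
    _ = ⨆ i, cramerSq (P i) (Q i) := by
      rw [← Finset.sum_mul, ← ENNReal.ofReal_sum_of_nonneg fun i _ ↦ hw i, hsum,
        ENNReal.ofReal_one, one_mul]
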